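/- Let α_1, α_2, α_3 ∈ ℝ with α_1 and α_2 not equal to any negative integer, and suppose 2n − α_3 + α_1 + α_2 + j ≠ 0 for j = 0, 1, 2. Define R_n(x) = Σ_{k=0}^n [(−n)_k (n − α_3 + α_1 + α_2 + 1)_k / ((α_1+1)_k (α_2+1)_k)] · (−x)_k / k!. Then for n ≥ 1 the three-term relation x R_n(x) = 𝔞_n R_{n+1}(x) − (𝔞_n + 𝔠_n) R_n(x) + 𝔠_n R_{n−1}(x) holds for all x ∈ ℝ, where 𝔞_n = (n+α_1+1)(n+α_2+1)(n−α_3+α_1+α_2+1) / [(2n−α_3+α_1+α_2+1)(2n−α_3+α_1+α_2+2)] and 𝔠_n = −n(n−α_3+α_1)(n−α_3+α_2) / [(2n−α_3+α_1+α_2)(2n−α_3+α_1+α_2+1)]. -/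

import Mathlib

open Finset

/-- Pochhammer symbol `(a)_k = a(a+1)⋯(a+k−1)`. -/
noncomputable def poch (a : ℝ) (k : ℕ) : ℝ := ∏ i ∈ Finset.range k, (a + i)

/-- The polynomials `R_n` of (4.10). -/
noncomputable def Rpol (α₁ α₂ α₃ : ℝ) (n : ℕ) (x : ℝ) : ℝ :=
  ∑ k ∈ Finset.range (n + 1),
    poch (-(n : ℝ)) k * poch ((n : ℝ) - α₃ + α₁ + α₂ + 1) k
      / (poch (α₁ + 1) k * poch (α₂ + 1) k) * poch (-x) k / (Nat.factorial k : ℝ)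

theorem poch_succ (a : ℝ) (k : ℕ) : poch a (k + 1) = poch a k * (a + k) :=
  Finset.prod_range_succ _ _

theorem poch_succ_left (a : ℝ) (k : ℕ) : poch a (k + 1) = a * poch (a + 1) k := by
  unfold poch
  rw [Finset.prod_range_succ', mul_comm]
  congr 1
  · simp
  · refine Finset.prod_congr rfl fun i _ => ?_
    push_cast
    ring

theorem mul_poch_add_one (a : ℝ) (k : ℕ) : a * poch (a + 1) k = poch a k * (a + k) := by
  rw [← poch_succ_left, poch_succ]

theorem poch_ne_zero {a : ℝ} (h : ∀ i : ℕ, a + i ≠ 0) (k : ℕ) : poch a k ≠ 0 :=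
  Finset.prod_ne_zero_iff.mpr fun i _ => h i

theorem poch_neg_natCast_eq_zero {n k : ℕ} (h : n < k) : poch (-(n : ℝ)) k = 0 :=
  Finset.prod_eq_zero (Finset.mem_range.mpr h) (neg_add_cancel _)

theorem add_one_add_natCast_ne_zero {a : ℝ} (h : ∀ m : ℤ, m < 0 → a ≠ (m : ℝ)) (i : ℕ) :
    a + 1 + i ≠ 0 := by
  intro hi
  refine h (-(i : ℤ) - 1) (by omega) ?_
  push_cast
  linarith

/-- The `k`-th summand of `Rpol`, with the degree replaced by a real parameter `t`. -/
noncomputable def RpolTerm (α₁ α₂ α₃ t x : ℝ) (k : ℕ) : ℝ :=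
  poch (-t) k * poch (t - α₃ + α₁ + α₂ + 1) k
    / (poch (α₁ + 1) k * poch (α₂ + 1) k) * poch (-x) k / (Nat.factorial k : ℝ)

/-- The sum defining `Rpol` terminates, so it may be extended past its last nonzero summand. -/
theorem Rpol_eq_sum_range (α₁ α₂ α₃ : ℝ) {n m : ℕ} (h : n < m) (x : ℝ) :
    Rpol α₁ α₂ α₃ n x = ∑ k ∈ Finset.range m, RpolTerm α₁ α₂ α₃ n x k := by
  refine Finset.sum_subset (Finset.range_mono h) fun k _ hk => ?_
  simp [poch_neg_natCast_eq_zero (n := n) (k := k) (by simpa using hk)]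

/-- The common factor of `RpolTerm α₁ α₂ α₃ t x (k + 1)` and its shifts by `t ± 1`. -/
noncomputable def RpolCommonFactor (α₁ α₂ α₃ t x : ℝ) (k : ℕ) : ℝ :=
  poch (-t) k * poch (t - α₃ + α₁ + α₂ + 1) k
    / (poch (α₁ + 1) (k + 1) * poch (α₂ + 1) (k + 1)) * poch (-x) (k + 1)
    / (Nat.factorial (k + 1) : ℝ)

theorem RpolTerm_succ (α₁ α₂ α₃ t x : ℝ) (k : ℕ) :
    RpolTerm α₁ α₂ α₃ t x (k + 1)
      = (-t + k) * (t - α₃ + α₁ + α₂ + 1 + k) * RpolCommonFactor α₁ α₂ α₃ t x k := by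
  unfold RpolTerm RpolCommonFactor
  rw [poch_succ (-t), poch_succ (t - α₃ + α₁ + α₂ + 1)]
  ring

theorem RpolTerm_mul_eq {α₁ α₂ α₃ : ℝ}
    (h₁ : ∀ i : ℕ, α₁ + 1 + i ≠ 0) (h₂ : ∀ i : ℕ, α₂ + 1 + i ≠ 0) (t x : ℝ) (k : ℕ) :
    RpolTerm α₁ α₂ α₃ t x k * (k - x)
      = (α₁ + 1 + k) * (α₂ + 1 + k) * (k + 1) * RpolCommonFactor α₁ α₂ α₃ t x k := by
  have hp₁ := poch_ne_zero h₁ k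
  have hp₂ := poch_ne_zero h₂ k
  have hk₁ := h₁ k
  have hk₂ := h₂ k
  have hf : (Nat.factorial k : ℝ) ≠ 0 := Nat.cast_ne_zero.mpr k.factorial_ne_zero
  have hk : (k : ℝ) + 1 ≠ 0 := k.cast_add_one_ne_zero
  unfold RpolTerm RpolCommonFactor
  rw [poch_succ (-x), poch_succ (α₁ + 1), poch_succ (α₂ + 1), Nat.factorial_succ]
  push_cast
  field_simp
  ring

theorem mul_RpolTerm_add_one_sub (α₁ α₂ α₃ t x : ℝ) (k : ℕ) :
    (t - α₃ + α₁ + α₂ + 1)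
        * (RpolTerm α₁ α₂ α₃ (t + 1) x (k + 1) - RpolTerm α₁ α₂ α₃ t x (k + 1))
      = -((t - α₃ + α₁ + α₂ + 1 + k) * (k + 1) * RpolCommonFactor α₁ α₂ α₃ t x k)
        * (2 * t - α₃ + α₁ + α₂ + 2) := by
  have hneg : poch (-(t + 1)) (k + 1) = -(t + 1) * poch (-t) k := by
    rw [poch_succ_left]; congr 2; ring
  have hpos : (t - α₃ + α₁ + α₂ + 1) * poch (t + 1 - α₃ + α₁ + α₂ + 1) (k + 1)
      = poch (t - α₃ + α₁ + α₂ + 1) k * (t - α₃ + α₁ + α₂ + 1 + k)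
        * (t - α₃ + α₁ + α₂ + 2 + k) := by
    rw [← mul_poch_add_one, poch_succ,
      show t + 1 - α₃ + α₁ + α₂ + 1 = t - α₃ + α₁ + α₂ + 1 + 1 by ring]
    ring
  have hadd : (t - α₃ + α₁ + α₂ + 1) * RpolTerm α₁ α₂ α₃ (t + 1) x (k + 1)
      = -(t + 1) * (t - α₃ + α₁ + α₂ + 1 + k) * (t - α₃ + α₁ + α₂ + 2 + k)
        * RpolCommonFactor α₁ α₂ α₃ t x k := by
    calc _ = poch (-(t + 1)) (k + 1)
          * ((t - α₃ + α₁ + α₂ + 1) * poch (t + 1 - α₃ + α₁ + α₂ + 1) (k + 1))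
          / (poch (α₁ + 1) (k + 1) * poch (α₂ + 1) (k + 1)) * poch (-x) (k + 1)
          / (Nat.factorial (k + 1) : ℝ) := by unfold RpolTerm; ring
      _ = _ := by rw [hneg, hpos]; unfold RpolCommonFactor; ring
  rw [mul_sub, hadd, RpolTerm_succ]
  ring

theorem mul_RpolTerm_sub_one_sub (α₁ α₂ α₃ t x : ℝ) (k : ℕ) :
    t * (RpolTerm α₁ α₂ α₃ (t - 1) x (k + 1) - RpolTerm α₁ α₂ α₃ t x (k + 1))
      = -((-t + k) * (k + 1) * RpolCommonFactor α₁ α₂ α₃ t x k)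
        * (2 * t - α₃ + α₁ + α₂) := by
  have hneg : t * poch (-(t - 1)) (k + 1) = -(poch (-t) k * (-t + k) * (-t + 1 + k)) := by
    rw [← mul_poch_add_one, poch_succ, show -(t - 1) = -t + 1 by ring]; ring
  have hpos : poch (t - 1 - α₃ + α₁ + α₂ + 1) (k + 1)
      = (t - α₃ + α₁ + α₂) * poch (t - α₃ + α₁ + α₂ + 1) k := by
    rw [poch_succ_left, show t - 1 - α₃ + α₁ + α₂ + 1 = t - α₃ + α₁ + α₂ by ring]
  have hsub : t * RpolTerm α₁ α₂ α₃ (t - 1) x (k + 1)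
      = -((-t + k) * (-t + 1 + k)) * (t - α₃ + α₁ + α₂)
        * RpolCommonFactor α₁ α₂ α₃ t x k := by
    calc _ = t * poch (-(t - 1)) (k + 1) * poch (t - 1 - α₃ + α₁ + α₂ + 1) (k + 1)
          / (poch (α₁ + 1) (k + 1) * poch (α₂ + 1) (k + 1)) * poch (-x) (k + 1)
          / (Nat.factorial (k + 1) : ℝ) := by unfold RpolTerm; ring
      _ = _ := by rw [hneg, hpos]; unfold RpolCommonFactor; ring
  rw [mul_sub, hsub, RpolTerm_succ]
  ring

/-- Each summand of the defect in the three-term relation is a difference of consecutive values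
of a hypergeometric term. -/
theorem RpolTerm_three_term_succ {α₁ α₂ α₃ t : ℝ}
    (h₁ : ∀ i : ℕ, α₁ + 1 + i ≠ 0) (h₂ : ∀ i : ℕ, α₂ + 1 + i ≠ 0)
    (hd₀ : 2 * t - α₃ + α₁ + α₂ ≠ 0) (hd₁ : 2 * t - α₃ + α₁ + α₂ + 1 ≠ 0)
    (hd₂ : 2 * t - α₃ + α₁ + α₂ + 2 ≠ 0) (x : ℝ) (k : ℕ) :
    (t + α₁ + 1) * (t + α₂ + 1) * (t - α₃ + α₁ + α₂ + 1)
        / ((2 * t - α₃ + α₁ + α₂ + 1) * (2 * t - α₃ + α₁ + α₂ + 2))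
        * (RpolTerm α₁ α₂ α₃ (t + 1) x (k + 1) - RpolTerm α₁ α₂ α₃ t x (k + 1))
      + -(t * (t - α₃ + α₁) * (t - α₃ + α₂))
        / ((2 * t - α₃ + α₁ + α₂) * (2 * t - α₃ + α₁ + α₂ + 1))
        * (RpolTerm α₁ α₂ α₃ (t - 1) x (k + 1) - RpolTerm α₁ α₂ α₃ t x (k + 1))
      - x * RpolTerm α₁ α₂ α₃ t x (k + 1)
      = RpolTerm α₁ α₂ α₃ t x (k + 1) * ((k + 1 : ℕ) - x)
        - RpolTerm α₁ α₂ α₃ t x k * (k - x) := by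
  calc _ = (t + α₁ + 1) * (t + α₂ + 1)
        / ((2 * t - α₃ + α₁ + α₂ + 1) * (2 * t - α₃ + α₁ + α₂ + 2))
        * ((t - α₃ + α₁ + α₂ + 1)
          * (RpolTerm α₁ α₂ α₃ (t + 1) x (k + 1) - RpolTerm α₁ α₂ α₃ t x (k + 1)))
      - (t - α₃ + α₁) * (t - α₃ + α₂)
        / ((2 * t - α₃ + α₁ + α₂) * (2 * t - α₃ + α₁ + α₂ + 1))
        * (t * (RpolTerm α₁ α₂ α₃ (t - 1) x (k + 1) - RpolTerm α₁ α₂ α₃ t x (k + 1)))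
      - x * RpolTerm α₁ α₂ α₃ t x (k + 1) := by ring
    _ = ((t - α₃ + α₁) * (t - α₃ + α₂) * (-t + k)
          - (t + α₁ + 1) * (t + α₂ + 1) * (t - α₃ + α₁ + α₂ + 1 + k))
        * (k + 1) * RpolCommonFactor α₁ α₂ α₃ t x k
        / (2 * t - α₃ + α₁ + α₂ + 1) - x * RpolTerm α₁ α₂ α₃ t x (k + 1) := by
      have cancel (p q d e : ℝ) (he : e ≠ 0) : p / (d * e) * (q * e) = p * q / d := by
        field_simp
      rw [mul_RpolTerm_add_one_sub, mul_RpolTerm_sub_one_sub, cancel _ _ _ _ hd₂,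
        mul_comm (2 * t - α₃ + α₁ + α₂) (2 * t - α₃ + α₁ + α₂ + 1), cancel _ _ _ _ hd₀]
      ring
    _ = _ := by
      rw [RpolTerm_mul_eq h₁ h₂ t x k, mul_sub (RpolTerm α₁ α₂ α₃ t x (k + 1)), mul_comm x,
        sub_right_comm, sub_left_inj, div_eq_iff hd₁, RpolTerm_succ]
      push_cast
      ring

/-- The partial sums of the defect in the three-term relation telescope. -/
theorem sum_RpolTerm_three_term {α₁ α₂ α₃ t : ℝ}
    (h₁ : ∀ i : ℕ, α₁ + 1 + i ≠ 0) (h₂ : ∀ i : ℕ, α₂ + 1 + i ≠ 0)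
    (hd₀ : 2 * t - α₃ + α₁ + α₂ ≠ 0) (hd₁ : 2 * t - α₃ + α₁ + α₂ + 1 ≠ 0)
    (hd₂ : 2 * t - α₃ + α₁ + α₂ + 2 ≠ 0) (x : ℝ) (m : ℕ) :
    ∑ k ∈ Finset.range (m + 1),
      ((t + α₁ + 1) * (t + α₂ + 1) * (t - α₃ + α₁ + α₂ + 1)
          / ((2 * t - α₃ + α₁ + α₂ + 1) * (2 * t - α₃ + α₁ + α₂ + 2))
          * (RpolTerm α₁ α₂ α₃ (t + 1) x k - RpolTerm α₁ α₂ α₃ t x k)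
        + -(t * (t - α₃ + α₁) * (t - α₃ + α₂))
          / ((2 * t - α₃ + α₁ + α₂) * (2 * t - α₃ + α₁ + α₂ + 1))
          * (RpolTerm α₁ α₂ α₃ (t - 1) x k - RpolTerm α₁ α₂ α₃ t x k)
        - x * RpolTerm α₁ α₂ α₃ t x k)
      = RpolTerm α₁ α₂ α₃ t x m * (m - x) := by
  induction m with
  | zero => simp [RpolTerm, poch]
  | succ m ih =>
    rw [Finset.sum_range_succ, ih, RpolTerm_three_term_succ h₁ h₂ hd₀ hd₁ hd₂]
    ring

/-- Proposition 4.2: the polynomials `R_n` satisfy the three-term relation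
`x R_n(x) = 𝔞_n R_{n+1}(x) − (𝔞_n + 𝔠_n) R_n(x) + 𝔠_n R_{n−1}(x)`. -/
theorem Rpol_three_term (α₁ α₂ α₃ : ℝ)
    (h₁ : ∀ m : ℤ, m < 0 → α₁ ≠ (m : ℝ))
    (h₂ : ∀ m : ℤ, m < 0 → α₂ ≠ (m : ℝ))
    (n : ℕ) (hn : 1 ≤ n)
    (hden : ∀ j : ℕ, j ≤ 2 → 2 * (n : ℝ) - α₃ + α₁ + α₂ + (j : ℝ) ≠ 0)
    (x : ℝ) :
    x * Rpol α₁ α₂ α₃ n x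
      = ((n : ℝ) + α₁ + 1) * ((n : ℝ) + α₂ + 1) * ((n : ℝ) - α₃ + α₁ + α₂ + 1)
            / ((2 * (n : ℝ) - α₃ + α₁ + α₂ + 1) * (2 * (n : ℝ) - α₃ + α₁ + α₂ + 2))
            * Rpol α₁ α₂ α₃ (n + 1) x
        - (((n : ℝ) + α₁ + 1) * ((n : ℝ) + α₂ + 1) * ((n : ℝ) - α₃ + α₁ + α₂ + 1)
            / ((2 * (n : ℝ) - α₃ + α₁ + α₂ + 1) * (2 * (n : ℝ) - α₃ + α₁ + α₂ + 2))
          + (-((n : ℝ) * ((n : ℝ) - α₃ + α₁) * ((n : ℝ) - α₃ + α₂))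
            / ((2 * (n : ℝ) - α₃ + α₁ + α₂) * (2 * (n : ℝ) - α₃ + α₁ + α₂ + 1))))
            * Rpol α₁ α₂ α₃ n x
        + (-((n : ℝ) * ((n : ℝ) - α₃ + α₁) * ((n : ℝ) - α₃ + α₂))
            / ((2 * (n : ℝ) - α₃ + α₁ + α₂) * (2 * (n : ℝ) - α₃ + α₁ + α₂ + 1)))
            * Rpol α₁ α₂ α₃ (n - 1) x := by
  have hlast : RpolTerm α₁ α₂ α₃ n x (n + 1) = 0 := by
    simp [RpolTerm, poch_neg_natCast_eq_zero n.lt_succ_self]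
  have key := sum_RpolTerm_three_term (α₃ := α₃) (t := n)
    (add_one_add_natCast_ne_zero h₁) (add_one_add_natCast_ne_zero h₂)
    (by simpa using hden 0 (by omega))
    (by simpa using hden 1 (by omega)) (by simpa using hden 2 le_rfl) x (n + 1)
  rw [hlast, zero_mul, Finset.sum_sub_distrib, Finset.sum_add_distrib, ← Finset.mul_sum,
    ← Finset.mul_sum, ← Finset.mul_sum, Finset.sum_sub_distrib, Finset.sum_sub_distrib] at key
  rw [Rpol_eq_sum_range α₁ α₂ α₃ (show n < n + 1 + 1 by omega),
    Rpol_eq_sum_range α₁ α₂ α₃ (show n + 1 < n + 1 + 1 by omega),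
    Rpol_eq_sum_range α₁ α₂ α₃ (show n - 1 < n + 1 + 1 by omega), Nat.cast_add_one,
    Nat.cast_pred hn]
  linear_combination -key
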